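/- Let b and f be functions holomorphic in a neighborhood of 0 in ℂ with Re(b(0)) > -1. Then the Cauchy problem w'(x) + (b(x)/x)·w(x) = f(x), w(0) = 0, has a unique solution w holomorphic near 0, given by w(x) = x ∫₀¹ t^{b(0)} exp(-x ∫_t¹ b̃(xs) ds) f(xt) dt, where b̃(x) = (b(x) - b(0))/x. -/

import Mathlib

open Metric in
theorem mul_ofReal_mem_ball {R : ℝ} {x : ℂ} (hx : x ∈ ball (0 : ℂ) R) {t : ℝ}
    (ht : t ∈ Set.Icc (0 : ℝ) 1) : x * (t : ℂ) ∈ ball (0 : ℂ) R := by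
  rw [mem_ball_zero_iff] at hx ⊢
  rw [norm_mul, Complex.norm_real, Real.norm_of_nonneg ht.1]
  exact (mul_le_of_le_one_right (norm_nonneg x) ht.2).trans_lt hx

open Metric in
theorem continuousOn_comp_mul_ofReal {g : ℂ → ℂ} {R : ℝ} (hg : ContinuousOn g (ball 0 R))
    {x : ℂ} (hx : x ∈ ball (0 : ℂ) R) :
    ContinuousOn (fun t : ℝ => g (x * (t : ℂ))) (Set.Icc 0 1) :=
  hg.comp (by fun_prop) fun _ ht => mul_ofReal_mem_ball hx ht

theorem intervalIntegrable_cpow_mul {β : ℂ} (hβ : -1 < β.re) {φ : ℝ → ℂ}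
    (hφ : ContinuousOn φ (Set.Icc 0 1)) :
    IntervalIntegrable (fun t : ℝ => (t : ℂ) ^ β * φ t) MeasureTheory.volume 0 1 :=
  (intervalIntegral.intervalIntegrable_cpow' hβ).mul_continuousOn
    (by rwa [Set.uIcc_of_le zero_le_one])

theorem add_one_ne_zero_of_neg_one_lt_re {β : ℂ} (hβ : -1 < β.re) : β + 1 ≠ 0 := by
  intro h
  have := congrArg Complex.re h
  simp at this
  linarith

open Metric in
theorem hasDerivAt_comp_mul_ofReal {h : ℂ → ℂ} {R : ℝ} (hh : DifferentiableOn ℂ h (ball 0 R))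
    {x : ℂ} (hx : x ∈ ball (0 : ℂ) R) {t : ℝ} (ht : t ∈ Set.Icc (0 : ℝ) 1) :
    HasDerivAt (fun t : ℝ => h (x * (t : ℂ))) (x * deriv h (x * (t : ℂ))) t := by
  have h1 : HasDerivAt h (deriv h (x * (t : ℂ))) (x * (t : ℂ)) :=
    (hh.differentiableAt (isOpen_ball.mem_nhds (mul_ofReal_mem_ball hx ht))).hasDerivAt
  have h2 : HasDerivAt (fun s : ℂ => x * s) x (t : ℂ) := by
    simpa using (hasDerivAt_id (t : ℂ)).const_mul x
  simpa [mul_comm] using (h1.comp (t : ℂ) h2).comp_ofReal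

/-- Integration by parts along a ray, for the Euler operator `z ↦ (β + 1) h + z h'`. -/
theorem integral_cpow_mul_euler {β : ℂ} (hβ : -1 < β.re) {h : ℂ → ℂ} {R : ℝ}
    (hh : DifferentiableOn ℂ h (Metric.ball 0 R)) {x : ℂ} (hx : x ∈ Metric.ball (0 : ℂ) R) :
    ∫ t in (0 : ℝ)..1, (t : ℂ) ^ β *
      ((β + 1) * h (x * t) + x * t * deriv h (x * t)) = h x := by
  have hβ1 := add_one_ne_zero_of_neg_one_lt_re hβ
  have hre : 0 < (β + 1).re := by simp; linarith
  have hc := continuousOn_comp_mul_ofReal hh.continuousOn hx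
  have hc' := continuousOn_comp_mul_ofReal (hh.deriv Metric.isOpen_ball).continuousOn hx
  rw [intervalIntegral.integral_eq_sub_of_hasDerivAt_of_le
    (f := fun t : ℝ => (t : ℂ) ^ (β + 1) * h (x * t)) zero_le_one]
  · simp [Complex.zero_cpow hβ1]
  · exact (Complex.continuous_ofReal_cpow_const hre).continuousOn.mul hc
  · intro t ht
    have h1 := (hasDerivAt_ofReal_cpow_const ht.1.ne' hβ1).mul
      (hasDerivAt_comp_mul_ofReal hh hx ⟨ht.1.le, ht.2.le⟩)
    refine h1.congr_deriv ?_
    rw [Complex.cpow_add _ _ (by exact_mod_cast ht.1.ne'), Complex.cpow_one, add_sub_cancel_right]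
    ring
  · exact intervalIntegrable_cpow_mul hβ ((continuousOn_const.mul hc).add
      ((Continuous.continuousOn (by fun_prop)).mul hc'))

open Metric in
theorem hasDerivAt_integral_cpow_mul {β : ℂ} (hβ : -1 < β.re) {g : ℂ → ℂ} {R : ℝ}
    (hg : DifferentiableOn ℂ g (ball 0 R)) {x : ℂ} (hx : x ∈ ball (0 : ℂ) R) :
    HasDerivAt (fun x => ∫ t in (0 : ℝ)..1, (t : ℂ) ^ β * g (x * t))
      (∫ t in (0 : ℝ)..1, (t : ℂ) ^ β * (t * deriv g (x * t))) x := by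
  have hg' := (hg.deriv isOpen_ball).continuousOn
  obtain ⟨ρ, hxρ, hρR⟩ := exists_between (mem_ball_zero_iff.1 hx)
  have hsub : closedBall (0 : ℂ) ρ ⊆ ball 0 R := closedBall_subset_ball hρR
  obtain ⟨C, hC⟩ := (isCompact_closedBall (0 : ℂ) ρ).exists_bound_of_continuousOn (hg'.mono hsub)
  have hs : ball (0 : ℂ) ρ ∈ nhds x := isOpen_ball.mem_nhds (mem_ball_zero_iff.2 hxρ)
  have hmem {y : ℂ} (hy : y ∈ ball (0 : ℂ) ρ) : y ∈ ball (0 : ℂ) R :=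
    hsub (ball_subset_closedBall hy)
  have hint {y : ℂ} (hy : y ∈ ball (0 : ℂ) ρ) :=
    intervalIntegrable_cpow_mul hβ (continuousOn_comp_mul_ofReal hg.continuousOn (hmem hy))
  have hc' := continuousOn_comp_mul_ofReal hg' hx
  have hIcc {t : ℝ} (ht : t ∈ Set.uIoc (0 : ℝ) 1) : t ∈ Set.Icc (0 : ℝ) 1 := by
    rw [Set.uIoc_of_le zero_le_one] at ht
    exact ⟨ht.1.le, ht.2⟩
  refine (intervalIntegral.hasDerivAt_integral_of_dominated_loc_of_deriv_le
    (F' := fun y t => (t : ℂ) ^ β * (t * deriv g (y * t)))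
    (bound := fun t : ℝ => ‖(t : ℂ) ^ β‖ * C) hs ?_ (hint (mem_ball_zero_iff.2 hxρ)) ?_ ?_ ?_ ?_).2
  · filter_upwards [hs] with y hy
    exact (hint hy).aestronglyMeasurable_restrict_uIoc
  · exact (intervalIntegrable_cpow_mul hβ
      (φ := fun t => t * deriv g (x * t)) (by fun_prop)).aestronglyMeasurable_restrict_uIoc
  · refine .of_forall fun t ht y hy => ?_
    have hb := hC _ (ball_subset_closedBall (mul_ofReal_mem_ball hy (hIcc ht)))
    rw [norm_mul, norm_mul, Complex.norm_real, Real.norm_of_nonneg (hIcc ht).1]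
    gcongr
    exact (mul_le_of_le_one_left (norm_nonneg _) (hIcc ht).2).trans hb
  · exact (intervalIntegral.intervalIntegrable_cpow' hβ).norm.mul_const C
  · refine .of_forall fun t ht y hy => ?_
    have h1 := (hg.differentiableAt
      (isOpen_ball.mem_nhds (mul_ofReal_mem_ball (hmem hy) (hIcc ht)))).hasDerivAt
    have h2 : HasDerivAt (fun y : ℂ => y * (t : ℂ)) t y := by
      simpa using (hasDerivAt_id y).mul_const (t : ℂ)
    simpa [mul_comm] using (h1.comp y h2).const_mul ((t : ℂ) ^ β)

/-- The average `x ↦ ∫₀¹ t ^ β g (x t) dt` solves `(β + 1) h + x h' = g`. -/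
theorem euler_integral_cpow_mul {β : ℂ} (hβ : -1 < β.re) {g : ℂ → ℂ} {R : ℝ}
    (hg : DifferentiableOn ℂ g (Metric.ball 0 R)) {x : ℂ} (hx : x ∈ Metric.ball (0 : ℂ) R) :
    (β + 1) * (∫ t in (0 : ℝ)..1, (t : ℂ) ^ β * g (x * t)) +
      x * (∫ t in (0 : ℝ)..1, (t : ℂ) ^ β * (t * deriv g (x * t))) = g x := by
  have hc := continuousOn_comp_mul_ofReal hg.continuousOn hx
  have hc' := continuousOn_comp_mul_ofReal (hg.deriv Metric.isOpen_ball).continuousOn hx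
  rw [← integral_cpow_mul_euler hβ hg hx, ← intervalIntegral.integral_const_mul,
    ← intervalIntegral.integral_const_mul, ← intervalIntegral.integral_add]
  · congr 1 with t
    ring
  · exact (intervalIntegrable_cpow_mul hβ hc).const_mul _
  · exact (intervalIntegrable_cpow_mul hβ
      (φ := fun t => t * deriv g (x * t)) (by fun_prop)).const_mul _

theorem hasDerivAt_mul_mul_exp_neg {h G : ℂ → ℂ} {h' G' z : ℂ} (hh : HasDerivAt h h' z)
    (hG : HasDerivAt G G' z) :
    HasDerivAt (fun z => z * h z * Complex.exp (-G z))
      ((h z + z * h' - z * G' * h z) * Complex.exp (-G z)) z := by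
  refine (((hasDerivAt_id z).mul hh).mul hG.neg.cexp).congr_deriv ?_
  simp
  ring

theorem stmt6 (b f bt : ℂ → ℂ)
    (hb : AnalyticAt ℂ b 0) (hf : AnalyticAt ℂ f 0) (hbt : AnalyticAt ℂ bt 0)
    (hbt' : ∀ x : ℂ, x ≠ 0 → bt x = (b x - b 0) / x)
    (hre : -1 < (b 0).re) :
    ∃ r > (0:ℝ), ∃ w : ℂ → ℂ,
      AnalyticOn ℂ w (Metric.ball 0 r) ∧ w 0 = 0 ∧
      (∀ x ∈ Metric.ball (0:ℂ) r, x ≠ 0 → deriv w x + (b x / x) * w x = f x) ∧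
      (∀ w' : ℂ → ℂ, AnalyticOn ℂ w' (Metric.ball 0 r) → w' 0 = 0 →
        (∀ x ∈ Metric.ball (0:ℂ) r, x ≠ 0 → deriv w' x + (b x / x) * w' x = f x) →
        Set.EqOn w' w (Metric.ball 0 r)) ∧
      (∀ x ∈ Metric.ball (0:ℂ) r,
        w x = x * ∫ t in (0:ℝ)..1, (t:ℂ) ^ (b 0) *
          Complex.exp (-x * ∫ s in t..1, bt (x * (s:ℂ))) * f (x * (t:ℂ))) := by
  obtain ⟨R₁, hR₁, hf₁⟩ := hf.exists_ball_analyticOnNhd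
  obtain ⟨R₂, hR₂, hbt₂⟩ := hbt.exists_ball_analyticOnNhd
  obtain ⟨R, hR, hRR₁, hRR₂⟩ : ∃ R > 0, R ≤ R₁ ∧ R ≤ R₂ :=
    ⟨min R₁ R₂, lt_min hR₁ hR₂, min_le_left _ _, min_le_right _ _⟩
  have hfR : DifferentiableOn ℂ f (Metric.ball 0 R) :=
    hf₁.differentiableOn.mono (Metric.ball_subset_ball hRR₁)
  have hbtR : DifferentiableOn ℂ bt (Metric.ball 0 R) :=
    hbt₂.differentiableOn.mono (Metric.ball_subset_ball hRR₂)
  obtain ⟨G, hG⟩ := hbtR.isExactOn_ball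
  have hGR : DifferentiableOn ℂ G (Metric.ball 0 R) := fun z hz =>
    (hG z hz).differentiableAt.differentiableWithinAt
  set g : ℂ → ℂ := fun z => Complex.exp (G z) * f z with hg_def
  have hg : DifferentiableOn ℂ g (Metric.ball 0 R) := hGR.cexp.mul hfR
  set J : ℂ → ℂ := fun x => ∫ t in (0 : ℝ)..1, (t : ℂ) ^ (b 0) * g (x * t) with hJ_def
  have hJ {x : ℂ} (hx : x ∈ Metric.ball (0 : ℂ) R) := hasDerivAt_integral_cpow_mul hre hg hx
  have hw {x : ℂ} (hx : x ∈ Metric.ball (0 : ℂ) R) := hasDerivAt_mul_mul_exp_neg (hJ hx) (hG x hx)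
  have hode {x : ℂ} (hx0 : x ≠ 0) (h h' : ℂ) :
      (h + x * h' - x * bt x * h) * Complex.exp (-G x) +
        b x / x * (x * h * Complex.exp (-G x)) = f x ↔
      (b 0 + 1) * h + x * h' = g x := by
    rw [hbt' x hx0, hg_def, Complex.exp_neg]
    have he := Complex.exp_ne_zero (G x)
    field_simp
    constructor <;> intro h <;> linear_combination h
  refine ⟨R, hR, fun x => x * J x * Complex.exp (-G x), ?_, by simp, ?_, ?_, ?_⟩
  · exact (Complex.analyticOn_iff_differentiableOn Metric.isOpen_ball).2 fun x hx =>
      (hw hx).differentiableAt.differentiableWithinAt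
  · intro x hx hx0
    rw [(hw hx).deriv]
    exact (hode hx0 _ _).2 (euler_integral_cpow_mul hre hg hx)
  · intro u hu hu0 huode x hx
    set k : ℂ → ℂ := fun z => u z * Complex.exp (G z) with hk_def
    have hk : DifferentiableOn ℂ k (Metric.ball 0 R) := hu.differentiableOn.mul hGR.cexp
    have hh : DifferentiableOn ℂ (dslope k 0) (Metric.ball 0 R) :=
      (Complex.differentiableOn_dslope (Metric.ball_mem_nhds 0 hR)).2 hk
    have hu_eq : u = fun z => z * dslope k 0 z * Complex.exp (-G z) := by
      funext z
      have := sub_smul_dslope k 0 z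
      simp only [sub_zero, smul_eq_mul, hk_def, hu0, zero_mul] at this
      rw [this, mul_assoc, ← Complex.exp_add, add_neg_cancel, Complex.exp_zero, mul_one]
    have heuler {z : ℂ} (hz : z ∈ Metric.ball (0 : ℂ) R) (hz0 : z ≠ 0) :
        (b 0 + 1) * dslope k 0 z + z * deriv (dslope k 0) z = g z := by
      have hd := (hh.differentiableAt (Metric.isOpen_ball.mem_nhds hz)).hasDerivAt
      have hud : deriv u z = _ :=
        (congrArg (deriv · z) hu_eq).trans (hasDerivAt_mul_mul_exp_neg hd (hG z hz)).deriv
      have := huode z hz hz0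
      rw [hud, congrFun hu_eq z] at this
      exact (hode hz0 _ _).1 this
    rcases eq_or_ne x 0 with rfl | hx0
    · simp [hu0]
    have hJx : dslope k 0 x = J x := by
      rw [← integral_cpow_mul_euler hre hh hx, hJ_def]
      refine intervalIntegral.integral_congr_ae (.of_forall fun t ht => ?_)
      rw [Set.uIoc_of_le zero_le_one] at ht
      rw [← heuler (mul_ofReal_mem_ball hx ⟨ht.1.le, ht.2⟩)
        (mul_ne_zero hx0 (by exact_mod_cast ht.1.ne'))]
    rw [congrFun hu_eq x, hJx]
  · intro x hx
    beta_reduce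
    rw [mul_assoc, hJ_def, mul_comm (∫ _ in _.._, _), ← intervalIntegral.integral_const_mul]
    congr 1
    refine intervalIntegral.integral_congr fun t ht => ?_
    rw [Set.uIcc_of_le zero_le_one] at ht
    have hsub : Set.uIcc t 1 ⊆ Set.Icc (0 : ℝ) 1 := by
      rw [Set.uIcc_of_le ht.2]
      exact Set.Icc_subset_Icc_left ht.1
    have hcont : ContinuousOn (fun s : ℝ => x * bt (x * (s : ℂ))) (Set.uIcc t 1) :=
      continuousOn_const.mul
        ((continuousOn_comp_mul_ofReal hbtR.continuousOn hx).mono hsub)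
    have hprim : x * ∫ s in t..1, bt (x * (s : ℂ)) = G x - G (x * t) := by
      rw [← intervalIntegral.integral_const_mul,
        intervalIntegral.integral_eq_sub_of_hasDerivAt (f := fun s : ℝ => G (x * (s : ℂ))) _
          hcont.intervalIntegrable]
      · simp
      · intro s hs
        have := hasDerivAt_comp_mul_ofReal hGR hx (hsub hs)
        rwa [(hG _ (mul_ofReal_mem_ball hx (hsub hs))).deriv] at this
    simp only [neg_mul, hprim, hg_def]
    rw [neg_sub, sub_eq_add_neg, Complex.exp_add]
    ring
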